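/- Let n ≥ 2 and let M ∈ SL(n,ℤ) have characteristic polynomial irreducible over ℚ. Then M is integer conjugate to a reduced perfect Hessenberg matrix of positive Hessenberg complexity. -/

import Mathlib

open Matrix Polynomial

/-- An n×n integer matrix is (upper) Hessenberg if `M i j = 0` whenever `i > j+1`
(0-based indices). -/
def IsHessenberg {n : ℕ} (M : Matrix (Fin n) (Fin n) ℤ) : Prop :=
  ∀ i j : Fin n, (j : ℕ) + 1 < (i : ℕ) → M i j = 0

/-- The subdiagonal entry `M (j+1) j` (0-based `j`), or `0` if out of range. -/
def subdiag {n : ℕ} (M : Matrix (Fin n) (Fin n) ℤ) (j : ℕ) : ℤ :=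
  if h : j + 1 < n then M ⟨j + 1, h⟩ ⟨j, Nat.lt_of_succ_lt h⟩ else 0

/-- Hessenberg complexity `ς(M) = ∏_{j=1}^{n-1} |M (j+1) j|^(n-j)` (1-based). -/
def hessComplexity {n : ℕ} (M : Matrix (Fin n) (Fin n) ℤ) : ℤ :=
  ∏ j ∈ Finset.range (n - 1), |subdiag M j| ^ (n - 1 - j)

/-- Integer conjugacy: `X * A * X⁻¹ = B` for some `X ∈ GL(n, ℤ)`. -/
def IntegerConjugate {n : ℕ} (A B : Matrix (Fin n) (Fin n) ℤ) : Prop :=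
  ∃ X : Matrix (Fin n) (Fin n) ℤ, IsUnit X.det ∧ X * A = B * X

/-- Perfect Hessenberg matrix: in `SL(n,ℤ)`, Hessenberg, irreducible characteristic
polynomial over ℚ, and `0 ≤ M i j < M (j+1) j` for `1 ≤ i ≤ j ≤ n-1` (1-based). -/
def IsPerfect {n : ℕ} (M : Matrix (Fin n) (Fin n) ℤ) : Prop :=
  M.det = 1 ∧ IsHessenberg M ∧
  Irreducible ((M.charpoly).map (Int.castRingHom ℚ)) ∧
  ∀ i j : Fin n, i ≤ j → (j : ℕ) + 1 < n → 0 ≤ M i j ∧ M i j < subdiag M (j : ℕ)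

/-- A perfect Hessenberg matrix is reduced if its Hessenberg complexity is minimal
among all perfect Hessenberg matrices integer conjugate to it. -/
def IsReducedHess {n : ℕ} (W : Matrix (Fin n) (Fin n) ℤ) : Prop :=
  IsPerfect W ∧ ∀ M : Matrix (Fin n) (Fin n) ℤ, IsPerfect M → IntegerConjugate W M →
    hessComplexity W ≤ hessComplexity M

theorem IntegerConjugate.refl {n : ℕ} (A : Matrix (Fin n) (Fin n) ℤ) : IntegerConjugate A A :=
  ⟨1, by simp, by simp⟩

theorem IntegerConjugate.trans {n : ℕ} {A B C : Matrix (Fin n) (Fin n) ℤ}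
    (hAB : IntegerConjugate A B) (hBC : IntegerConjugate B C) : IntegerConjugate A C := by
  obtain ⟨X, hX, hXA⟩ := hAB
  obtain ⟨Y, hY, hYB⟩ := hBC
  refine ⟨Y * X, by rw [det_mul]; exact hY.mul hX, ?_⟩
  rw [Matrix.mul_assoc, hXA, ← Matrix.mul_assoc, hYB, Matrix.mul_assoc]

theorem IntegerConjugate.det_eq {n : ℕ} {A B : Matrix (Fin n) (Fin n) ℤ}
    (h : IntegerConjugate A B) : A.det = B.det := by
  obtain ⟨X, hX, hXA⟩ := h
  have hdet := congrArg Matrix.det hXA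
  rw [det_mul, det_mul, mul_comm] at hdet
  exact hX.mul_right_cancel hdet

theorem IntegerConjugate.charpoly_eq {n : ℕ} {A B : Matrix (Fin n) (Fin n) ℤ}
    (h : IntegerConjugate A B) : A.charpoly = B.charpoly := by
  obtain ⟨X, hX, hXA⟩ := h
  have hB : B = X * A * X⁻¹ := by
    rw [hXA, Matrix.mul_assoc, mul_nonsing_inv _ hX, Matrix.mul_one]
  obtain ⟨U, rfl⟩ := (isUnit_iff_isUnit_det X).2 hX
  rw [hB, charpoly_units_conj]

/-- A matrix whose characteristic polynomial is irreducible over `ℚ` preserves no proper nonempty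
coordinate subspace. -/
theorem Matrix.exists_entry_ne_zero_of_irreducible_charpoly {ι : Type*} [Fintype ι]
    [DecidableEq ι] {H : Matrix ι ι ℤ}
    (hirr : Irreducible (H.charpoly.map (Int.castRingHom ℚ))) (p : ι → Prop) [DecidablePred p]
    (hp : ∃ i, p i) (hnp : ∃ i, ¬ p i) : ∃ i j, ¬ p i ∧ p j ∧ H i j ≠ 0 := by
  by_contra! hzero
  have hfactor : H.charpoly =
      (H.toSquareBlockProp p).charpoly * (H.toSquareBlockProp fun i ↦ ¬ p i).charpoly := by
    rw [charpoly, twoBlockTriangular_det _ p, charpoly, charpoly]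
    · congr 2 <;> ext i j : 2 <;> simp [toSquareBlockProp, charmatrix_apply, diagonal_apply,
        Subtype.ext_iff]
    · intro i hi j hj
      have hij : i ≠ j := by rintro rfl; exact hi hj
      simp [charmatrix_apply_ne _ _ _ hij, hzero i j hi hj]
  have not_unit : ∀ (q : ι → Prop) [DecidablePred q], (∃ i, q i) →
      ¬ IsUnit ((H.toSquareBlockProp q).charpoly.map (Int.castRingHom ℚ)) := by
    rintro q _ ⟨i, hi⟩ hunit
    have hmonic := (charpoly_monic (H.toSquareBlockProp q)).map (Int.castRingHom ℚ)
    have hdeg := (charpoly_monic (H.toSquareBlockProp q)).natDegree_map (Int.castRingHom ℚ)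
    rw [hmonic.eq_one_of_isUnit hunit, charpoly_natDegree_eq_dim, natDegree_one] at hdeg
    exact (Fintype.card_pos_iff.2 ⟨(⟨i, hi⟩ : {i // q i})⟩).ne hdeg
  rw [hfactor, Polynomial.map_mul] at hirr
  exact (hirr.isUnit_or_isUnit rfl).elim (not_unit p hp) (not_unit _ hnp)

/-- `v` is carried to `w` by a unimodular matrix fixing every vector supported on the coordinates
`0, …, k`. -/
def UnimodularReach {n : ℕ} (k : ℕ) (v w : Fin n → ℤ) : Prop :=
  ∃ X : Matrix (Fin n) (Fin n) ℤ, IsUnit X.det ∧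
    (∀ x : Fin n → ℤ, (∀ i : Fin n, k < i → x i = 0) → X *ᵥ x = x) ∧ X *ᵥ v = w

theorem UnimodularReach.trans {n k : ℕ} {u v w : Fin n → ℤ} (huv : UnimodularReach k u v)
    (hvw : UnimodularReach k v w) : UnimodularReach k u w := by
  obtain ⟨X, hX, hXfix, rfl⟩ := huv
  obtain ⟨Y, hY, hYfix, rfl⟩ := hvw
  refine ⟨Y * X, by rw [det_mul]; exact hY.mul hX, fun x hx ↦ ?_, ?_⟩
  · rw [← mulVec_mulVec, hXfix x hx, hYfix x hx]
  · rw [mulVec_mulVec]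

theorem unimodularReach_add_smul {n k : ℕ} (v u : Fin n → ℤ) (m : Fin n) (hm : k < m)
    (hu : IsUnit (1 + u m)) : UnimodularReach k v (v + v m • u) := by
  have hact : ∀ x : Fin n → ℤ, (1 + vecMulVec u (Pi.single m 1)) *ᵥ x = x + x m • u := by
    intro x
    rw [add_mulVec, one_mulVec, vecMulVec_mulVec]
    ext i
    simp [mul_comm]
  refine ⟨1 + vecMulVec u (Pi.single m 1), ?_, fun x hx ↦ ?_, hact v⟩
  · rw [vecMulVec_eq Unit, det_one_add_replicateCol_mul_replicateRow]
    simpa using hu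
  · rw [hact, hx m hm, zero_smul, add_zero]

/-- A vector with a nonzero entry beyond coordinate `k` can be carried to one which vanishes beyond
`k + 1` and whose first `k + 1` entries are reduced modulo the entry at `k + 1`. -/
theorem exists_unimodularReach_reduced {n k : ℕ} (hk : k + 1 < n) :
    ∀ (v : Fin n → ℤ) (m : Fin n), k < m → v m ≠ 0 →
      ∃ w, UnimodularReach k v w ∧ (∀ i : Fin n, k + 1 < i → w i = 0) ∧
        ∀ i : Fin n, i ≤ k → 0 ≤ w i ∧ w i < w ⟨k + 1, hk⟩ := by
  intro v m hm hvm
  induction hN : (v m).natAbs using Nat.strong_induction_on generalizing v m with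
  | _ N ih =>
  subst hN
  set u : Fin n → ℤ := fun i ↦ if i = m then 0 else -(v i / v m) with hu
  have hum : u m = 0 := by simp [hu]
  have hreach : UnimodularReach k v (v + v m • u) :=
    unimodularReach_add_smul v u m hm (by simp [hum])
  set v' := v + v m • u with hv'
  have hv'm : v' m = v m := by simp [hv', hum]
  have hv'i : ∀ i, i ≠ m → v' i = v i % v m := by
    intro i hi
    simp only [hv', hu, Pi.add_apply, Pi.smul_apply, smul_eq_mul, if_neg hi]
    rw [Int.emod_def]
    ring
  by_cases hrest : ∃ i : Fin n, k < i ∧ i ≠ m ∧ v' i ≠ 0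
  · obtain ⟨i, hki, him, hi⟩ := hrest
    have hlt : (v' i).natAbs < (v m).natAbs := by
      have h1 := Int.emod_nonneg (v i) hvm
      have h2 := Int.emod_lt_abs (v i) hvm
      rw [hv'i i him]
      rw [Int.abs_eq_natAbs] at h2
      omega
    obtain ⟨w, hw, hw'⟩ := ih _ hlt v' i hki hi rfl
    exact ⟨w, hreach.trans hw, hw'⟩
  push Not at hrest
  have hsmall : ∀ i : Fin n, i ≤ k → 0 ≤ v' i ∧ v' i < |v m| := by
    intro i hi
    rw [hv'i i (by rintro rfl; omega)]
    exact ⟨Int.emod_nonneg _ hvm, Int.emod_lt_abs _ hvm⟩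
  obtain ⟨s, hs, hs1⟩ : ∃ s : ℤ, IsUnit s ∧ |v m| = v m * s := by
    rcases abs_choice (v m) with h | h
    · exact ⟨1, isUnit_one, by rw [h, mul_one]⟩
    · exact ⟨-1, isUnit_one.neg, by rw [h]; ring⟩
  have hss : s * s = 1 := Int.isUnit_mul_self hs
  by_cases hmk : m = ⟨k + 1, hk⟩
  · have hstep := unimodularReach_add_smul v' (Pi.single m (s - 1)) m hm (by simpa using hs)
    refine ⟨_, hreach.trans hstep, fun i hi ↦ ?_, fun i hi ↦ ?_⟩
    · have him : i ≠ m := by rintro rfl; rw [hmk] at hi; simp at hi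
      simp [him, hrest i (by omega) him]
    · have him : i ≠ m := by rintro rfl; omega
      have hlast : (v' + v' m • (Pi.single m (s - 1) : Fin n → ℤ)) m = |v m| := by
        simp [hv'm, hs1]; ring
      rw [← hmk, hlast]
      simpa [him] using hsmall i hi
  · set c : Fin n := ⟨k + 1, hk⟩ with hc
    have hck : k < (c : ℕ) := by simp [hc]
    have hcm : c ≠ m := Ne.symm hmk
    have hv'c : v' c = 0 := hrest c hck hcm
    have hstep := unimodularReach_add_smul v' (Pi.single c s) m hm (by simp [hmk])
    set v₂ := v' + v' m • Pi.single c s with hv₂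
    have hv₂c : v₂ c = |v m| := by simp [hv₂, hv'c, hv'm, hs1]
    have hv₂m : v₂ m = v m := by simp [hv₂, hmk, hv'm]
    have hstep₂ := unimodularReach_add_smul v₂ (Pi.single m (-s)) c hck (by simp [hcm])
    refine ⟨_, (hreach.trans hstep).trans hstep₂, fun i hi ↦ ?_, fun i hi ↦ ?_⟩
    · have hic : i ≠ c := by rintro rfl; simp [hc] at hi
      by_cases him : i = m
      · subst him
        simp only [Pi.add_apply, Pi.smul_apply, Pi.single_eq_same, smul_eq_mul, hv₂m, hv₂c, hs1]
        linear_combination (-v i) * hss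
      · simp [him, hv₂, hic, hrest i (by omega) him]
    · have him : i ≠ m := by rintro rfl; omega
      have hic : i ≠ c := by rintro rfl; omega
      have hlast : (v₂ + v₂ c • (Pi.single m (-s) : Fin n → ℤ)) c = |v m| := by simp [hcm, hv₂c]
      rw [hlast]
      simpa [him, hv₂, hic] using hsmall i hi

/-- The columns `0, …, k - 1` of `H` satisfy the conditions of a perfect Hessenberg matrix. -/
def IsPerfectBelow {n : ℕ} (k : ℕ) (H : Matrix (Fin n) (Fin n) ℤ) : Prop :=
  ∀ j : Fin n, (j : ℕ) < k → (j : ℕ) + 1 < n →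
    (∀ i : Fin n, (j : ℕ) + 1 < i → H i j = 0) ∧
      ∀ i : Fin n, i ≤ j → 0 ≤ H i j ∧ H i j < subdiag H j

theorem IsPerfectBelow.exists_succ {n k : ℕ} (hk : k + 1 < n) {H : Matrix (Fin n) (Fin n) ℤ}
    (hH : IsPerfectBelow k H) (hirr : Irreducible (H.charpoly.map (Int.castRingHom ℚ))) :
    ∃ H', IntegerConjugate H H' ∧ IsPerfectBelow (k + 1) H' := by
  set c : Fin n := ⟨k, by omega⟩ with hc
  obtain ⟨m, hm, hne⟩ : ∃ m : Fin n, k < m ∧ H m c ≠ 0 := by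
    obtain ⟨i, j, hi, hj, hij⟩ := exists_entry_ne_zero_of_irreducible_charpoly hirr
      (fun i ↦ (i : ℕ) ≤ k) ⟨c, le_rfl⟩ ⟨⟨k + 1, hk⟩, by simp⟩
    have hjk : ¬ (j : ℕ) < k := fun hjk ↦ hij ((hH j hjk (by omega)).1 i (by omega))
    obtain rfl : j = c := Fin.ext (by simp only [hc]; omega)
    exact ⟨i, by omega, hij⟩
  obtain ⟨w, ⟨X, hX, hfix, hXw⟩, hw0, hwr⟩ := exists_unimodularReach_reduced hk (H.col c) m hm hne
  have hinv : X⁻¹ * X = 1 := nonsing_inv_mul _ hX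
  have hcol : ∀ j : Fin n, (j : ℕ) ≤ k → (X * H * X⁻¹).col j = X *ᵥ H.col j := by
    intro j hj
    have hXj : X *ᵥ Pi.single j 1 = Pi.single j 1 :=
      hfix _ fun i hi ↦ Pi.single_eq_of_ne (by rintro rfl; omega) _
    have hXinv : X⁻¹ *ᵥ Pi.single j 1 = Pi.single j 1 := by
      conv_lhs => rw [← hXj]
      rw [mulVec_mulVec, hinv, one_mulVec]
    rw [← mulVec_single_one, ← mulVec_mulVec, hXinv, ← mulVec_mulVec, mulVec_single_one]
  refine ⟨X * H * X⁻¹, ⟨X, hX, by rw [Matrix.mul_assoc, hinv, Matrix.mul_one]⟩,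
    fun j hj hjn ↦ ?_⟩
  rcases Nat.lt_succ_iff_lt_or_eq.1 hj with hjk | hjk
  · obtain ⟨h0, hr⟩ := hH j hjk hjn
    have hentry : ∀ i, (X * H * X⁻¹) i j = H i j := fun i ↦ congrFun
      ((hcol j hjk.le).trans (hfix _ fun i hi ↦ h0 i (by omega))) i
    simpa only [subdiag, hentry, Fin.eta] using And.intro h0 hr
  · obtain rfl : j = c := Fin.ext hjk
    have hentry : ∀ i, (X * H * X⁻¹) i c = w i := fun i ↦ congrFun ((hcol c le_rfl).trans hXw) i
    refine ⟨fun i hi ↦ (hentry i).trans (hw0 i hi), fun i hi ↦ ?_⟩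
    have hsub : subdiag (X * H * X⁻¹) (c : ℕ) = w ⟨k + 1, hk⟩ := by
      rw [subdiag, dif_pos hjn]
      exact hentry _
    rw [hsub, hentry]
    exact hwr i hi

theorem exists_integerConjugate_isPerfect {n : ℕ} (M : Matrix (Fin n) (Fin n) ℤ)
    (hdet : M.det = 1) (hirr : Irreducible (M.charpoly.map (Int.castRingHom ℚ))) :
    ∃ H, IsPerfect H ∧ IntegerConjugate M H := by
  have hbelow : ∀ k, k ≤ n - 1 → ∃ H, IntegerConjugate M H ∧ IsPerfectBelow k H := by
    intro k
    induction k with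
    | zero => exact fun _ ↦ ⟨M, .refl M, fun j hj ↦ absurd hj (Nat.not_lt_zero _)⟩
    | succ k ih =>
      intro hk
      obtain ⟨H, hMH, hH⟩ := ih (by omega)
      obtain ⟨H', hHH', hH'⟩ := hH.exists_succ (by omega) (hMH.charpoly_eq ▸ hirr)
      exact ⟨H', hMH.trans hHH', hH'⟩
  obtain ⟨H, hMH, hH⟩ := hbelow (n - 1) le_rfl
  refine ⟨H, ⟨hMH.det_eq ▸ hdet, fun i j hij ↦ ?_, hMH.charpoly_eq ▸ hirr, fun i j hij hj ↦ ?_⟩,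
    hMH⟩
  · exact (hH j (by omega) (by omega)).1 i hij
  · exact (hH j (by omega) hj).2 i hij

theorem IsPerfect.subdiag_ne_zero {n : ℕ} {H : Matrix (Fin n) (Fin n) ℤ} (hH : IsPerfect H)
    {j : ℕ} (hj : j + 1 < n) : subdiag H j ≠ 0 :=
  have hdiag := hH.2.2.2 ⟨j, by omega⟩ ⟨j, by omega⟩ le_rfl hj
  (hdiag.1.trans_lt hdiag.2).ne'

theorem hessComplexity_nonneg {n : ℕ} (H : Matrix (Fin n) (Fin n) ℤ) : 0 ≤ hessComplexity H :=
  Finset.prod_nonneg fun _ _ ↦ pow_nonneg (abs_nonneg _) _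

/-- Any `M ∈ SL(n,ℤ)` (n ≥ 2) with characteristic polynomial irreducible
over ℚ is integer conjugate to a reduced perfect Hessenberg matrix of positive
Hessenberg complexity. -/
theorem statement1 (n : ℕ) (hn : 2 ≤ n) (M : Matrix (Fin n) (Fin n) ℤ)
    (hdet : M.det = 1)
    (hirr : Irreducible ((M.charpoly).map (Int.castRingHom ℚ))) :
    ∃ H : Matrix (Fin n) (Fin n) ℤ, IsReducedHess H ∧
      (∀ j : ℕ, j + 1 < n → subdiag H j ≠ 0) ∧ IntegerConjugate M H := by
  obtain ⟨H₀, hH₀, hMH₀⟩ := exists_integerConjugate_isPerfect M hdet hirr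
  obtain ⟨H, ⟨hH, hMH⟩, hmin⟩ := exists_minimalFor_of_wellFoundedLT
    (fun H ↦ IsPerfect H ∧ IntegerConjugate M H) (fun H ↦ (hessComplexity H).toNat)
    ⟨H₀, hH₀, hMH₀⟩
  refine ⟨H, ⟨hH, fun A hA hHA ↦ ?_⟩, fun j hj ↦ hH.subdiag_ne_zero hj, hMH⟩
  have hle := (le_total (hessComplexity H).toNat (hessComplexity A).toNat).elim id
    (hmin ⟨hA, hMH.trans hHA⟩)
  have hnonneg := hessComplexity_nonneg A
  omega
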